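/- For every α ∈ (0,1], the Petz Augustin information is bounded by the Shannon entropy of the prior: I^{(2)}_α(P,W) ≤ −Σ_i P(i)·log P(i), where 0·log 0 := 0. -/

import Mathlib

open Matrix
open scoped ComplexOrder

/-- Real power of a (hermitian) matrix via the continuous functional calculus. -/
noncomputable def mpow {ι : Type*} [Fintype ι] [DecidableEq ι]
    (A : Matrix ι ι ℂ) (r : ℝ) : Matrix ι ι ℂ :=
  cfc (fun x : ℝ => x ^ r) A

/-- Logarithm of a (hermitian) matrix via the continuous functional calculus. -/
noncomputable def mlog {ι : Type*} [Fintype ι] [DecidableEq ι]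
    (A : Matrix ι ι ℂ) : Matrix ι ι ℂ :=
  cfc Real.log A

/-- Real part of the trace. -/
noncomputable def trR {ι : Type*} [Fintype ι] (A : Matrix ι ι ℂ) : ℝ :=
  (Matrix.trace A).re

/-- Positive definite density matrices. -/
def Dens (d : ℕ) : Type :=
  {σ : Matrix (Fin d) (Fin d) ℂ // σ.PosDef ∧ σ.trace = 1}

/-- Umegaki relative entropy. -/
noncomputable def Dumegaki {d : ℕ} (ρ σ : Matrix (Fin d) (Fin d) ℂ) : ℝ :=
  trR (ρ * (mlog ρ - mlog σ))

/-- Petz Rényi divergence, extended to `α = 1` by the Umegaki relative entropy. -/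
noncomputable def DpetzFull {d : ℕ} (α : ℝ) (ρ σ : Matrix (Fin d) (Fin d) ℂ) : ℝ :=
  if α = 1 then Dumegaki ρ σ
  else (1 / (α - 1)) * Real.log (trR (mpow ρ α * mpow σ (1 - α)))

/-- Petz Augustin information. -/
noncomputable def augustinInfo {d n : ℕ} (α : ℝ) (W : Fin n → Matrix (Fin d) (Fin d) ℂ)
    (P : Fin n → ℝ) : ℝ :=
  ⨅ σ : Dens d, ∑ i, P i * DpetzFull α (W i) σ.1

open scoped MatrixOrder Matrix.Norms.L2Operator

section MatrixFunctions

variable {ι : Type*} [Fintype ι]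

lemma trR_add (A B : Matrix ι ι ℂ) : trR (A + B) = trR A + trR B := by
  simp [trR]

lemma trR_sub (A B : Matrix ι ι ℂ) : trR (A - B) = trR A - trR B := by
  simp [trR]

lemma trR_smul (c : ℝ) (A : Matrix ι ι ℂ) : trR (c • A) = c * trR A := by
  simp [trR, Matrix.trace_smul]

variable [DecidableEq ι] {A B C : Matrix ι ι ℂ}

lemma mpow_eq_rpow (hA : 0 ≤ A) (r : ℝ) : mpow A r = A ^ r :=
  (CFC.rpow_eq_cfc_real hA).symm

lemma mpow_smul (hA : 0 ≤ A) {c : ℝ} (hc : 0 ≤ c) (r : ℝ) :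
    mpow (c • A) r = c ^ r • mpow A r := by
  have hsa : IsSelfAdjoint A := .of_nonneg hA
  rw [mpow, mpow, ← cfc_comp_smul c (fun x : ℝ => x ^ r) A
    ((A.finite_real_spectrum.image _).continuousOn _) hsa,
    ← cfc_smul (c ^ r) (fun x : ℝ => x ^ r) A (A.finite_real_spectrum.continuousOn _)]
  refine cfc_congr fun x hx => ?_
  simpa using Real.mul_rpow hc (spectrum_nonneg_of_nonneg hA hx)

lemma mpow_mul_mpow_one_sub (hA : A.PosDef) (r : ℝ) : mpow A r * mpow A (1 - r) = A := by
  have hA0 : 0 ≤ A := hA.posSemidef.nonneg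
  rw [mpow_eq_rpow hA0, mpow_eq_rpow hA0, ← CFC.rpow_add hA.isUnit]
  simp [CFC.rpow_one A hA0]

lemma trR_mul_nonneg (hA : 0 ≤ A) (hB : 0 ≤ B) : 0 ≤ trR (A * B) := by
  obtain ⟨X, rfl⟩ := CStarAlgebra.nonneg_iff_eq_star_mul_self.mp hA
  have h := (hB.posSemidef.mul_mul_conjTranspose_same X).trace_nonneg
  rw [trR, Matrix.star_eq_conjTranspose, mul_assoc, Matrix.trace_mul_comm]
  exact (Complex.nonneg_iff.mp h).1

lemma trR_mul_le_trR_mul (hA : 0 ≤ A) (hBC : B ≤ C) : trR (A * B) ≤ trR (A * C) := by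
  have := trR_mul_nonneg hA (sub_nonneg.mpr hBC)
  rw [mul_sub, trR_sub] at this
  linarith

end MatrixFunctions

section Divergence

variable {d : ℕ} {ρ σ : Matrix (Fin d) (Fin d) ℂ} {c : ℝ}

lemma Dumegaki_le_neg_log (hρ : ρ.PosDef) (hρ1 : ρ.trace = 1) (hc : 0 < c) (h : c • ρ ≤ σ) :
    Dumegaki ρ σ ≤ -Real.log c := by
  have hρ' : IsStrictlyPositive ρ := hρ.isStrictlyPositive
  have hlog : algebraMap ℝ _ (Real.log c) + mlog ρ ≤ mlog σ := by
    have := CFC.log_le_log h (hρ'.smul hc)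
    rwa [CFC.log_smul' ρ hc hρ'] at this
  have := trR_mul_le_trR_mul hρ'.nonneg hlog
  rw [mul_add, trR_add, Algebra.algebraMap_eq_smul_one, mul_smul_comm, mul_one, trR_smul,
    show trR ρ = 1 by simp [trR, hρ1]] at this
  rw [Dumegaki, mul_sub, trR_sub]
  linarith

lemma DpetzFull_le_neg_log {α : ℝ} (hα : α ∈ Set.Ioc (0 : ℝ) 1) (hρ : ρ.PosDef)
    (hρ1 : ρ.trace = 1) (hc : 0 < c) (h : c • ρ ≤ σ) :
    DpetzFull α ρ σ ≤ -Real.log c := by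
  rw [DpetzFull]
  split_ifs with h1
  · exact Dumegaki_le_neg_log hρ hρ1 hc h
  have hα1 : 0 < 1 - α := sub_pos.mpr (lt_of_le_of_ne hα.2 h1)
  have hρ0 : 0 ≤ ρ := hρ.posSemidef.nonneg
  have hcρ0 : 0 ≤ c • ρ := smul_nonneg hc.le hρ0
  have hpow : c ^ (1 - α) • mpow ρ (1 - α) ≤ mpow σ (1 - α) := by
    rw [← mpow_smul hρ0 hc.le, mpow_eq_rpow hcρ0, mpow_eq_rpow (hcρ0.trans h)]
    exact CFC.rpow_le_rpow ⟨hα1.le, by linarith [hα.1]⟩ h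
  have htr : c ^ (1 - α) ≤ trR (mpow ρ α * mpow σ (1 - α)) := by
    have := trR_mul_le_trR_mul (A := mpow ρ α)
      (by rw [mpow_eq_rpow hρ0]; exact CFC.rpow_nonneg) hpow
    rwa [mul_smul_comm, mpow_mul_mpow_one_sub hρ, trR_smul,
      show trR ρ = 1 by simp [trR, hρ1], mul_one] at this
  have hlog := Real.log_le_log (Real.rpow_pos_of_pos hc _) htr
  rw [Real.log_rpow hc] at hlog
  rw [one_div, ← div_eq_inv_mul, div_le_iff_of_neg (by linarith)]
  linarith

end Divergence

/-- the Petz Augustin information is bounded by the Shannon entropy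
of the prior, for every `α ∈ (0,1]`. -/
theorem augustinInfo_le_shannonEntropy {d n : ℕ} (hd : 0 < d) (hn : 0 < n)
    (W : Fin n → Matrix (Fin d) (Fin d) ℂ)
    (hW : ∀ i, (W i).PosDef ∧ (W i).trace = 1)
    (P : Fin n → ℝ) (hP : ∀ i, 0 ≤ P i) (hP1 : ∑ i, P i = 1)
    (α : ℝ) (hα : α ∈ Set.Ioc (0 : ℝ) 1) :
    augustinInfo α W P ≤ -∑ i, P i * Real.log (P i) := by
  by_cases hbdd : BddBelow (Set.range fun σ : Dens d => ∑ i, P i * DpetzFull α (W i) σ.1)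
  · have hle (i : Fin n) : P i • W i ≤ ∑ j, P j • W j :=
      Finset.single_le_sum (f := fun j => P j • W j)
        (fun j _ => smul_nonneg (hP j) (hW j).1.posSemidef.nonneg) (Finset.mem_univ i)
    obtain ⟨k, hk⟩ : ∃ k, 0 < P k := by
      by_contra! hneg
      linarith [Finset.sum_nonpos fun i (_ : i ∈ Finset.univ) => hneg i]
    have hpos : (∑ j, P j • W j).PosDef :=
      (((hW k).1.isStrictlyPositive.smul hk).of_le (hle k)).posDef
    have htr : (∑ j, P j • W j).trace = 1 := by
      simp_rw [Matrix.trace_sum, Matrix.trace_smul, (hW _).2]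
      rw [← Finset.sum_smul, hP1, one_smul]
    refine (ciInf_le hbdd (⟨_, hpos, htr⟩ : Dens d)).trans ?_
    rw [← Finset.sum_neg_distrib]
    refine Finset.sum_le_sum fun i _ => ?_
    rcases (hP i).eq_or_lt with h0 | hi
    · simp [← h0]
    · rw [← mul_neg]
      exact mul_le_mul_of_nonneg_left
        (DpetzFull_le_neg_log hα (hW i).1 (hW i).2 hi (hle i)) hi.le
  · rw [augustinInfo, Real.iInf_of_not_bddBelow hbdd, ← Finset.sum_neg_distrib]
    refine Finset.sum_nonneg fun i _ => ?_
    have hPi : P i ≤ 1 :=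
      hP1 ▸ Finset.single_le_sum (fun j _ => hP j) (Finset.mem_univ i)
    exact neg_nonneg.mpr (Real.mul_log_nonpos (hP i) hPi)
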